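/- Let ω be a 3-form on a 6-dimensional real vector space V with volume form θ and Hitchin pfaffian λ(ω) < 0. Then ω = α + ᾱ where α is a complex decomposable 3-form on V ⊗ ℂ; moreover α is unique subject to (α ∧ ᾱ)/(iθ) > 0. -/

import Mathlib

/- Framework: exterior forms on a real vector space `V` are modelled as elements of the
exterior algebra of the dual space; a `k`-form is an element of the submodule
`⋀[ℝ]^k (Module.Dual ℝ V)`, and the wedge product is the algebra multiplication. -/

noncomputable section
open ExteriorAlgebra
set_option synthInstance.maxHeartbeats 1000000
set_option maxHeartbeats 1000000

variable (V : Type) [AddCommGroup V] [Module ℝ V]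

/-- The algebra of exterior forms on `V`. -/
abbrev EForm := ExteriorAlgebra ℝ (Module.Dual ℝ V)

variable {V}

/-- Interior product (contraction) of forms by a vector, linear in the vector. -/
def iContrL : V →ₗ[ℝ] Module.End ℝ (EForm V) :=
  (CliffordAlgebra.contractLeft (Q := (0 : QuadraticForm ℝ (Module.Dual ℝ V)))).comp
    (Module.Dual.eval ℝ V)

/-- Contraction of forms by an arbitrary element of the exterior algebra of `V`
(e.g. by a bivector), extending `iContrL` as an algebra morphism. -/
def aContr : ExteriorAlgebra ℝ V →ₐ[ℝ] Module.End ℝ (EForm V) :=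
  ExteriorAlgebra.lift ℝ ⟨iContrL, fun _ =>
    LinearMap.ext fun _ => CliffordAlgebra.contractLeft_contractLeft _ _⟩

/-- The bilinear form on `V` associated with an exterior 2-form, via double contraction
(the scalar part is extracted by `ExteriorAlgebra.algebraMapInv`). -/
def formToBilin (Om : EForm V) : V →ₗ[ℝ] V →ₗ[ℝ] ℝ :=
  LinearMap.mk₂ ℝ (fun x y => algebraMapInv (iContrL y (iContrL x Om)))
    (fun x x' y => by simp [map_add, LinearMap.add_apply])
    (fun c x y => by simp [map_smul, LinearMap.smul_apply])
    (fun x y y' => by simp [map_add, LinearMap.add_apply])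
    (fun c x y => by simp [map_smul, LinearMap.smul_apply])

/-- A 2-form is nondegenerate (symplectic) if its associated bilinear form is. -/
def IsSymplecticForm (Om : EForm V) : Prop :=
  Om ∈ ⋀[ℝ]^2 (Module.Dual ℝ V) ∧ ∀ x : V, (∀ y : V, formToBilin Om x y = 0) → x = 0

/-- The algebra morphism `⋀ V → ⋀ V*` induced by a linear map `Γ : V → V*`. -/
def extAlgMap (f : V →ₗ[ℝ] Module.Dual ℝ V) : ExteriorAlgebra ℝ V →ₐ[ℝ] EForm V :=
  ExteriorAlgebra.lift ℝ ⟨(ExteriorAlgebra.ι ℝ).comp f, fun _ => ι_sq_zero _⟩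

/-- `XOm` is the bivector dual to the symplectic form `Om`, i.e. the unique bivector with
`Γ^*(X_Ω) = Ω` where `Γ : V → V*` is the isomorphism induced by `Om`. -/
def IsDualBivector (Om : EForm V) (XOm : ExteriorAlgebra ℝ V) : Prop :=
  XOm ∈ ⋀[ℝ]^2 V ∧ extAlgMap (formToBilin Om) XOm = Om

/-- The pullback action on forms induced by an endomorphism `K : V → V`. -/
def formPullback (K : V →ₗ[ℝ] V) : EForm V →ₐ[ℝ] EForm V :=
  ExteriorAlgebra.lift ℝ ⟨(ExteriorAlgebra.ι ℝ).comp K.dualMap, fun _ => ι_sq_zero _⟩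


/-- `(ρ, σ)` is the pair of real and imaginary parts of a complex decomposable 3-form
`α = (a₀ + i b₀) ∧ (a₁ + i b₁) ∧ (a₂ + i b₂)` on `V ⊗ ℂ`. -/
def IsComplexDecompPair (ρ σ : EForm V) : Prop :=
  ∃ a b : Fin 3 → Module.Dual ℝ V,
    (ρ = ExteriorAlgebra.ι ℝ (a 0) * ExteriorAlgebra.ι ℝ (a 1) * ExteriorAlgebra.ι ℝ (a 2)
        - ExteriorAlgebra.ι ℝ (a 0) * ExteriorAlgebra.ι ℝ (b 1) * ExteriorAlgebra.ι ℝ (b 2)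
        - ExteriorAlgebra.ι ℝ (b 0) * ExteriorAlgebra.ι ℝ (a 1) * ExteriorAlgebra.ι ℝ (b 2)
        - ExteriorAlgebra.ι ℝ (b 0) * ExteriorAlgebra.ι ℝ (b 1) * ExteriorAlgebra.ι ℝ (a 2)) ∧
    (σ = ExteriorAlgebra.ι ℝ (a 0) * ExteriorAlgebra.ι ℝ (a 1) * ExteriorAlgebra.ι ℝ (b 2)
        + ExteriorAlgebra.ι ℝ (a 0) * ExteriorAlgebra.ι ℝ (b 1) * ExteriorAlgebra.ι ℝ (a 2)
        + ExteriorAlgebra.ι ℝ (b 0) * ExteriorAlgebra.ι ℝ (a 1) * ExteriorAlgebra.ι ℝ (a 2)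
        - ExteriorAlgebra.ι ℝ (b 0) * ExteriorAlgebra.ι ℝ (b 1) * ExteriorAlgebra.ι ℝ (b 2))



lemma iContrL_ι_mul (X : V) (f : Module.Dual ℝ V) (y : EForm V) :
    iContrL X (ExteriorAlgebra.ι ℝ f * y) = f X • y - ExteriorAlgebra.ι ℝ f * iContrL X y :=
  CliffordAlgebra.contractLeft_ι_mul _ _ _

lemma iContrL_ι (X : V) (f : Module.Dual ℝ V) :
    iContrL X (ExteriorAlgebra.ι ℝ f) = algebraMap ℝ (EForm V) (f X) :=
  CliffordAlgebra.contractLeft_ι _ _ _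

lemma iContrL_algebraMap (X : V) (r : ℝ) : iContrL X (algebraMap ℝ (EForm V) r) = 0 :=
  CliffordAlgebra.contractLeft_algebraMap _ _ _

lemma iContrL_self (X : V) (y : EForm V) : iContrL X (iContrL X y) = 0 :=
  CliffordAlgebra.contractLeft_contractLeft _ _

lemma iContrL_comm (X Y : V) (y : EForm V) :
    iContrL X (iContrL Y y) = -iContrL Y (iContrL X y) :=
  CliffordAlgebra.contractLeft_comm _ _ _

lemma iContrL_smul_left (c : ℝ) (X : V) (y : EForm V) :
    iContrL (c • X) y = c • iContrL X y := by
  rw [map_smul, LinearMap.smul_apply]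

lemma ι_mul_ι_swap (f g : Module.Dual ℝ V) :
    ExteriorAlgebra.ι ℝ f * ExteriorAlgebra.ι ℝ g
      = -(ExteriorAlgebra.ι ℝ g * ExteriorAlgebra.ι ℝ f) :=
  eq_neg_of_add_eq_zero_left (ι_add_mul_swap f g)

lemma iContrL_mem {n : ℕ} (X : V) {η : EForm V} (hη : η ∈ ⋀[ℝ]^(n + 1) (Module.Dual ℝ V)) :
    iContrL X η ∈ ⋀[ℝ]^n (Module.Dual ℝ V) := by
  suffices h : ∀ (m : ℕ) (η : EForm V), η ∈ ⋀[ℝ]^m (Module.Dual ℝ V) →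
      (m = 0 → iContrL X η = 0) ∧
      (∀ n, m = n + 1 → iContrL X η ∈ ⋀[ℝ]^n (Module.Dual ℝ V)) from (h _ η hη).2 n rfl
  intro m η hη
  induction hη using Submodule.pow_induction_on_left' with
  | algebraMap r => exact ⟨fun _ => iContrL_algebraMap X r, fun n hn => by omega⟩
  | add x y i hx hy hx' hy' =>
    refine ⟨fun h => ?_, fun n h => ?_⟩
    · rw [map_add, hx'.1 h, hy'.1 h, add_zero]
    · rw [map_add]; exact add_mem (hx'.2 n h) (hy'.2 n h)
  | mem_mul m hm i x hx ih =>
    obtain ⟨f, rfl⟩ := hm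
    refine ⟨fun h => by omega, fun n h => ?_⟩
    obtain rfl : i = n := by omega
    rw [iContrL_ι_mul]
    refine sub_mem (Submodule.smul_mem _ _ hx) ?_
    cases i with
    | zero => rw [ih.1 rfl, mul_zero]; exact zero_mem _
    | succ k =>
      have := Submodule.mul_mem_mul (LinearMap.mem_range_self (ExteriorAlgebra.ι ℝ) f)
        (ih.2 k rfl)
      rwa [exteriorPower, pow_succ']

lemma iContrL_mul {n : ℕ} (X : V) {η : EForm V} (hη : η ∈ ⋀[ℝ]^n (Module.Dual ℝ V))
    (y : EForm V) :
    iContrL X (η * y) = iContrL X η * y + (-1 : ℝ) ^ n • (η * iContrL X y) := by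
  induction hη using Submodule.pow_induction_on_left' with
  | algebraMap r =>
    rw [iContrL_algebraMap, Algebra.algebraMap_eq_smul_one, smul_mul_assoc, smul_mul_assoc,
      map_smul]
    simp
  | add x z i hx hz hx' hz' =>
    rw [add_mul, map_add, map_add, hx', hz', add_mul, add_mul, smul_add]
    abel
  | mem_mul m hm i x hx ih =>
    obtain ⟨f, rfl⟩ := hm
    rw [mul_assoc, iContrL_ι_mul, iContrL_ι_mul, ih, mul_add, mul_smul_comm, pow_succ, sub_mul,
      smul_mul_assoc, mul_assoc, mul_assoc]
    module

lemma ι_mul_comm_graded {n : ℕ} (f : Module.Dual ℝ V) {η : EForm V}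
    (hη : η ∈ ⋀[ℝ]^n (Module.Dual ℝ V)) :
    ExteriorAlgebra.ι ℝ f * η = (-1 : ℝ) ^ n • (η * ExteriorAlgebra.ι ℝ f) := by
  induction hη using Submodule.pow_induction_on_left' with
  | algebraMap r =>
    rw [Algebra.commutes, pow_zero, one_smul]
  | add x z i hx hz hx' hz' => rw [mul_add, hx', hz', add_mul, smul_add]
  | mem_mul m hm i x hx ih =>
    obtain ⟨g, rfl⟩ := hm
    rw [← mul_assoc, ι_mul_ι_swap, neg_mul, mul_assoc, ih, pow_succ, mul_smul_comm, mul_assoc]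
    module

lemma mul_comm_graded {m n : ℕ} {ξ η : EForm V} (hξ : ξ ∈ ⋀[ℝ]^m (Module.Dual ℝ V))
    (hη : η ∈ ⋀[ℝ]^n (Module.Dual ℝ V)) :
    ξ * η = (-1 : ℝ) ^ (m * n) • (η * ξ) := by
  induction hξ using Submodule.pow_induction_on_left' with
  | algebraMap r => rw [Algebra.commutes, zero_mul, pow_zero, one_smul]
  | add x z i hx hz hx' hz' => rw [add_mul, hx', hz', mul_add, smul_add]
  | mem_mul k hk i x hx ih =>
    obtain ⟨g, rfl⟩ := hk
    rw [mul_assoc, ih, mul_smul_comm, ← mul_assoc, ι_mul_comm_graded g hη, smul_mul_assoc,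
      smul_smul, ← pow_add, mul_assoc, Nat.succ_mul]

lemma sum_ι_coord_mul_iContrL {κ : Type} [Fintype κ] (b : Module.Basis κ ℝ V) {n : ℕ}
    {η : EForm V} (hη : η ∈ ⋀[ℝ]^n (Module.Dual ℝ V)) :
    ∑ j, ExteriorAlgebra.ι ℝ (b.coord j) * iContrL (b j) η = (n : ℝ) • η := by
  induction hη using Submodule.pow_induction_on_left' with
  | algebraMap r => simp [iContrL_algebraMap]
  | add x z i hx hz hx' hz' =>
    simp only [map_add, mul_add, Finset.sum_add_distrib, hx', hz', smul_add]
  | mem_mul k hk i x hx ih =>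
    obtain ⟨g, rfl⟩ := hk
    have h1 : ∑ j, ExteriorAlgebra.ι ℝ (b.coord j) * (g (b j) • x)
        = ExteriorAlgebra.ι ℝ g * x := by
      conv_rhs => rw [← b.sum_dual_apply_smul_coord g]
      rw [map_sum, Finset.sum_mul]
      refine Finset.sum_congr rfl fun j _ => ?_
      rw [map_smul, smul_mul_assoc, mul_smul_comm]
    have h2 : ∑ j, ExteriorAlgebra.ι ℝ (b.coord j) * (ExteriorAlgebra.ι ℝ g * iContrL (b j) x)
        = -(ExteriorAlgebra.ι ℝ g * ((i : ℝ) • x)) := by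
      rw [← ih, Finset.mul_sum, ← Finset.sum_neg_distrib]
      refine Finset.sum_congr rfl fun j _ => ?_
      rw [← mul_assoc, ι_mul_ι_swap, neg_mul, mul_assoc]
    simp only [iContrL_ι_mul, mul_sub, Finset.sum_sub_distrib, h1, h2]
    rw [mul_smul_comm]
    push_cast
    module

lemma eq_zero_of_iContrL_eq_zero [FiniteDimensional ℝ V] {n : ℕ} {η : EForm V}
    (hη : η ∈ ⋀[ℝ]^(n + 1) (Module.Dual ℝ V)) (h : ∀ X : V, iContrL X η = 0) : η = 0 := by
  have := sum_ι_coord_mul_iContrL (Module.finBasis ℝ V) hη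
  simp only [h, mul_zero, Finset.sum_const_zero] at this
  exact (smul_eq_zero.mp this.symm).resolve_left (by positivity)

lemma eq_of_iContrL_eq [FiniteDimensional ℝ V] {n : ℕ} {η ξ : EForm V}
    (hη : η ∈ ⋀[ℝ]^(n + 1) (Module.Dual ℝ V)) (hξ : ξ ∈ ⋀[ℝ]^(n + 1) (Module.Dual ℝ V))
    (h : ∀ X : V, iContrL X η = iContrL X ξ) : η = ξ :=
  sub_eq_zero.mp <| eq_zero_of_iContrL_eq_zero (sub_mem hη hξ) fun X => by
    rw [map_sub, h, sub_self]

section TopForm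

variable [FiniteDimensional ℝ V] {n : ℕ} (hdim : Module.finrank ℝ V = n)
  {θ : EForm V} (hθ : θ ∈ ⋀[ℝ]^n (Module.Dual ℝ V)) (hθ0 : θ ≠ 0)
include hdim hθ

lemma ι_mul_top_form (f : Module.Dual ℝ V) : ExteriorAlgebra.ι ℝ f * θ = 0 := by
  have hmem : ExteriorAlgebra.ι ℝ f * θ ∈ ⋀[ℝ]^(n + 1) (Module.Dual ℝ V) := by
    rw [exteriorPower, pow_succ']
    exact Submodule.mul_mem_mul (LinearMap.mem_range_self _ f) hθ
  have h0 : Module.finrank ℝ (⋀[ℝ]^(n + 1) (Module.Dual ℝ V)) = 0 := by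
    rw [exteriorPower.finrank_eq, Subspace.dual_finrank_eq, hdim, Nat.choose_succ_self]
  rw [Submodule.finrank_eq_zero.mp h0] at hmem
  exact (Submodule.mem_bot ℝ).mp hmem

lemma ι_mul_iContrL_top_form (f : Module.Dual ℝ V) (X : V) :
    ExteriorAlgebra.ι ℝ f * iContrL X θ = f X • θ := by
  have h := iContrL_ι_mul X f θ
  rw [ι_mul_top_form hdim hθ, map_zero] at h
  exact (sub_eq_zero.mp h.symm).symm

include hθ0

lemma eq_zero_of_iContrL_top_form {X : V} (h : iContrL X θ = 0) : X = 0 := by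
  refine (Module.forall_dual_apply_eq_zero_iff ℝ X).mp fun f => ?_
  have := ι_mul_iContrL_top_form hdim hθ f X
  rw [h, mul_zero] at this
  exact (smul_eq_zero.mp this.symm).resolve_right hθ0

lemma smul_eq_smul_of_iContrL_iContrL_top_form {X Y : V} (h : iContrL X (iContrL Y θ) = 0)
    (f : Module.Dual ℝ V) : f X • Y = f Y • X := by
  refine sub_eq_zero.mp (eq_zero_of_iContrL_top_form hdim hθ hθ0 ?_)
  have h1 := iContrL_ι_mul X f (iContrL Y θ)
  rw [h, mul_zero, ι_mul_iContrL_top_form hdim hθ, map_smul] at h1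
  rw [map_sub, LinearMap.sub_apply, iContrL_smul_left, iContrL_smul_left, h1]
  simp

lemma exists_eq_smul_of_iContrL_iContrL_top_form {X Y : V} (hX : X ≠ 0)
    (h : iContrL X (iContrL Y θ) = 0) : ∃ c : ℝ, Y = c • X := by
  obtain ⟨f, hf⟩ : ∃ f : Module.Dual ℝ V, f X ≠ 0 := by
    by_contra! hf
    exact hX ((Module.forall_dual_apply_eq_zero_iff ℝ X).mp hf)
  refine ⟨(f X)⁻¹ * f Y, ?_⟩
  rw [mul_smul, ← smul_eq_smul_of_iContrL_iContrL_top_form hdim hθ hθ0 h f, smul_smul,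
    inv_mul_cancel₀ hf, one_smul]

end TopForm

lemma iContrL_ι_mul_ι_mul_ι (X : V) (f g h : Module.Dual ℝ V) :
    iContrL X (ExteriorAlgebra.ι ℝ f * ExteriorAlgebra.ι ℝ g * ExteriorAlgebra.ι ℝ h)
      = f X • (ExteriorAlgebra.ι ℝ g * ExteriorAlgebra.ι ℝ h)
        - g X • (ExteriorAlgebra.ι ℝ f * ExteriorAlgebra.ι ℝ h)
        + h X • (ExteriorAlgebra.ι ℝ f * ExteriorAlgebra.ι ℝ g) := by
  rw [mul_assoc, iContrL_ι_mul, iContrL_ι_mul, iContrL_ι, Algebra.algebraMap_eq_smul_one]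
  simp only [mul_sub, mul_smul_comm, mul_one]
  abel

lemma ι_mul_ι_mul_ι_mem (f g h : Module.Dual ℝ V) :
    ExteriorAlgebra.ι ℝ f * ExteriorAlgebra.ι ℝ g * ExteriorAlgebra.ι ℝ h
      ∈ ⋀[ℝ]^3 (Module.Dual ℝ V) := by
  rw [exteriorPower, pow_succ, pow_two]
  exact Submodule.mul_mem_mul (Submodule.mul_mem_mul (LinearMap.mem_range_self _ f)
    (LinearMap.mem_range_self _ g)) (LinearMap.mem_range_self _ h)

lemma ι_mul_ι_swap_assoc (f g : Module.Dual ℝ V) (x : EForm V) :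
    ExteriorAlgebra.ι ℝ f * (ExteriorAlgebra.ι ℝ g * x)
      = -(ExteriorAlgebra.ι ℝ g * (ExteriorAlgebra.ι ℝ f * x)) := by
  rw [← mul_assoc, ι_mul_ι_swap, neg_mul, mul_assoc]

lemma ι_mul_ι_self_assoc (f : Module.Dual ℝ V) (x : EForm V) :
    ExteriorAlgebra.ι ℝ f * (ExteriorAlgebra.ι ℝ f * x) = 0 := by
  rw [← mul_assoc, ι_sq_zero, zero_mul]

/-- The real part of `(a₀ + i b₀) ∧ (a₁ + i b₁) ∧ (a₂ + i b₂)`. -/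
def decompRe (a b : Fin 3 → Module.Dual ℝ V) : EForm V :=
  ExteriorAlgebra.ι ℝ (a 0) * ExteriorAlgebra.ι ℝ (a 1) * ExteriorAlgebra.ι ℝ (a 2)
    - ExteriorAlgebra.ι ℝ (a 0) * ExteriorAlgebra.ι ℝ (b 1) * ExteriorAlgebra.ι ℝ (b 2)
    - ExteriorAlgebra.ι ℝ (b 0) * ExteriorAlgebra.ι ℝ (a 1) * ExteriorAlgebra.ι ℝ (b 2)
    - ExteriorAlgebra.ι ℝ (b 0) * ExteriorAlgebra.ι ℝ (b 1) * ExteriorAlgebra.ι ℝ (a 2)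

/-- The imaginary part of `(a₀ + i b₀) ∧ (a₁ + i b₁) ∧ (a₂ + i b₂)`. -/
def decompIm (a b : Fin 3 → Module.Dual ℝ V) : EForm V :=
  ExteriorAlgebra.ι ℝ (a 0) * ExteriorAlgebra.ι ℝ (a 1) * ExteriorAlgebra.ι ℝ (b 2)
    + ExteriorAlgebra.ι ℝ (a 0) * ExteriorAlgebra.ι ℝ (b 1) * ExteriorAlgebra.ι ℝ (a 2)
    + ExteriorAlgebra.ι ℝ (b 0) * ExteriorAlgebra.ι ℝ (a 1) * ExteriorAlgebra.ι ℝ (a 2)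
    - ExteriorAlgebra.ι ℝ (b 0) * ExteriorAlgebra.ι ℝ (b 1) * ExteriorAlgebra.ι ℝ (b 2)

section Decomp

variable (a b : Fin 3 → Module.Dual ℝ V)

lemma decompRe_mem : decompRe a b ∈ ⋀[ℝ]^3 (Module.Dual ℝ V) :=
  sub_mem (sub_mem (sub_mem (ι_mul_ι_mul_ι_mem _ _ _) (ι_mul_ι_mul_ι_mem _ _ _))
    (ι_mul_ι_mul_ι_mem _ _ _)) (ι_mul_ι_mul_ι_mem _ _ _)

lemma decompIm_mem : decompIm a b ∈ ⋀[ℝ]^3 (Module.Dual ℝ V) :=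
  sub_mem (add_mem (add_mem (ι_mul_ι_mul_ι_mem _ _ _) (ι_mul_ι_mul_ι_mem _ _ _))
    (ι_mul_ι_mul_ι_mem _ _ _)) (ι_mul_ι_mul_ι_mem _ _ _)

lemma ι_mul_decomp (j : Fin 3) :
    ExteriorAlgebra.ι ℝ (a j) * decompRe a b = ExteriorAlgebra.ι ℝ (b j) * decompIm a b ∧
    ExteriorAlgebra.ι ℝ (b j) * decompRe a b = -(ExteriorAlgebra.ι ℝ (a j) * decompIm a b) := by
  simp only [decompRe, decompIm, mul_sub, mul_add, mul_assoc]
  fin_cases j <;>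
  simp only [Fin.zero_eta, Fin.mk_one, Fin.reduceFinMk,
    ι_mul_ι_swap_assoc (b 0) (a 0), ι_mul_ι_swap_assoc (a 1) (a 0), ι_mul_ι_swap_assoc (a 1) (b 0),
    ι_mul_ι_swap_assoc (b 1) (a 0), ι_mul_ι_swap_assoc (b 1) (b 0), ι_mul_ι_swap_assoc (b 1) (a 1),
    ι_mul_ι_swap_assoc (a 2) (a 0), ι_mul_ι_swap_assoc (a 2) (b 0), ι_mul_ι_swap_assoc (a 2) (a 1),
    ι_mul_ι_swap_assoc (a 2) (b 1), ι_mul_ι_swap_assoc (b 2) (a 0), ι_mul_ι_swap_assoc (b 2) (b 0),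
    ι_mul_ι_swap_assoc (b 2) (a 1), ι_mul_ι_swap_assoc (b 2) (b 1), ι_mul_ι_swap (b 2) (a 2),
    ι_mul_ι_self_assoc, ι_sq_zero, mul_neg, mul_zero] <;>
  constructor <;> abel

lemma iContrL_decompRe (X : V) :
    iContrL X (decompRe a b) =
      a 0 X • (ExteriorAlgebra.ι ℝ (a 1) * ExteriorAlgebra.ι ℝ (a 2)
        - ExteriorAlgebra.ι ℝ (b 1) * ExteriorAlgebra.ι ℝ (b 2))
      - b 0 X • (ExteriorAlgebra.ι ℝ (a 1) * ExteriorAlgebra.ι ℝ (b 2)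
        + ExteriorAlgebra.ι ℝ (b 1) * ExteriorAlgebra.ι ℝ (a 2))
      - a 1 X • (ExteriorAlgebra.ι ℝ (a 0) * ExteriorAlgebra.ι ℝ (a 2)
        - ExteriorAlgebra.ι ℝ (b 0) * ExteriorAlgebra.ι ℝ (b 2))
      + b 1 X • (ExteriorAlgebra.ι ℝ (a 0) * ExteriorAlgebra.ι ℝ (b 2)
        + ExteriorAlgebra.ι ℝ (b 0) * ExteriorAlgebra.ι ℝ (a 2))
      + a 2 X • (ExteriorAlgebra.ι ℝ (a 0) * ExteriorAlgebra.ι ℝ (a 1)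
        - ExteriorAlgebra.ι ℝ (b 0) * ExteriorAlgebra.ι ℝ (b 1))
      - b 2 X • (ExteriorAlgebra.ι ℝ (a 0) * ExteriorAlgebra.ι ℝ (b 1)
        + ExteriorAlgebra.ι ℝ (b 0) * ExteriorAlgebra.ι ℝ (a 1)) := by
  simp only [decompRe, map_sub, iContrL_ι_mul_ι_mul_ι]
  module

lemma iContrL_decompIm (X : V) :
    iContrL X (decompIm a b) =
      a 0 X • (ExteriorAlgebra.ι ℝ (a 1) * ExteriorAlgebra.ι ℝ (b 2)
        + ExteriorAlgebra.ι ℝ (b 1) * ExteriorAlgebra.ι ℝ (a 2))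
      + b 0 X • (ExteriorAlgebra.ι ℝ (a 1) * ExteriorAlgebra.ι ℝ (a 2)
        - ExteriorAlgebra.ι ℝ (b 1) * ExteriorAlgebra.ι ℝ (b 2))
      - a 1 X • (ExteriorAlgebra.ι ℝ (a 0) * ExteriorAlgebra.ι ℝ (b 2)
        + ExteriorAlgebra.ι ℝ (b 0) * ExteriorAlgebra.ι ℝ (a 2))
      - b 1 X • (ExteriorAlgebra.ι ℝ (a 0) * ExteriorAlgebra.ι ℝ (a 2)
        - ExteriorAlgebra.ι ℝ (b 0) * ExteriorAlgebra.ι ℝ (b 2))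
      + a 2 X • (ExteriorAlgebra.ι ℝ (a 0) * ExteriorAlgebra.ι ℝ (b 1)
        + ExteriorAlgebra.ι ℝ (b 0) * ExteriorAlgebra.ι ℝ (a 1))
      + b 2 X • (ExteriorAlgebra.ι ℝ (a 0) * ExteriorAlgebra.ι ℝ (a 1)
        - ExteriorAlgebra.ι ℝ (b 0) * ExteriorAlgebra.ι ℝ (b 1)) := by
  simp only [decompIm, map_sub, map_add, iContrL_ι_mul_ι_mul_ι]
  module

lemma iContrL_decompRe_mul_decompIm (X : V) :
    iContrL X (decompRe a b) * decompIm a b = -(iContrL X (decompIm a b) * decompRe a b) := by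
  have ha (j : Fin 3) := (ι_mul_decomp a b j).1
  have hb (j : Fin 3) := (ι_mul_decomp a b j).2
  rw [iContrL_decompRe, iContrL_decompIm]
  simp only [sub_mul, add_mul, smul_mul_assoc, mul_assoc, ha, hb, mul_neg]
  module

/-- A linear map which acts on the complex 1-forms `a j + i b j` as multiplication by `-i c`
exchanges the real and imaginary parts of their product under contraction. -/
lemma iContrL_decomp_of_map {c : ℝ} {X Y : V} (ha : ∀ j, a j Y = c * b j X)
    (hb : ∀ j, b j Y = -(c * a j X)) :
    iContrL Y (decompRe a b) = c • iContrL X (decompIm a b) ∧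
    iContrL Y (decompIm a b) = -(c • iContrL X (decompRe a b)) := by
  simp only [iContrL_decompRe, iContrL_decompIm, ha, hb]
  constructor <;> module

end Decomp

section Uniqueness

variable [FiniteDimensional ℝ V] (hdim : Module.finrank ℝ V = 6)
  {θ : EForm V} (hθ : θ ∈ ⋀[ℝ]^6 (Module.Dual ℝ V)) (hθ0 : θ ≠ 0)
  (a b : Fin 3 → Module.Dual ℝ V) {c : ℝ} (hc : decompRe a b * decompIm a b = c • θ)
include hdim hθ hθ0 hc

lemma dual_apply_of_ι_mul_decomp {p q : Module.Dual ℝ V}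
    (hpq : ExteriorAlgebra.ι ℝ p * decompRe a b = ExteriorAlgebra.ι ℝ q * decompIm a b)
    {X Y : V} (hY : iContrL X ((2 : ℝ) • decompRe a b) * ((2 : ℝ) • decompRe a b) = iContrL Y θ) :
    p Y = 2 * c * q X := by
  have hcomm (f : Module.Dual ℝ V) (y : EForm V) :
      ExteriorAlgebra.ι ℝ f * (iContrL X (decompRe a b) * y)
        = iContrL X (decompRe a b) * (ExteriorAlgebra.ι ℝ f * y) := by
    rw [← mul_assoc, ι_mul_comm_graded f (iContrL_mem X (decompRe_mem a b))]
    simp [mul_assoc]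
  have h1 : p Y • θ = (4 : ℝ) •
      (ExteriorAlgebra.ι ℝ q * (iContrL X (decompRe a b) * decompIm a b)) := by
    rw [← ι_mul_iContrL_top_form hdim hθ, ← hY, map_smul, smul_mul_assoc, mul_smul_comm,
      mul_smul_comm, mul_smul_comm, hcomm, hpq, hcomm, smul_smul]
    norm_num
  have h2 : q X • (c • θ) = (2 : ℝ) •
      (ExteriorAlgebra.ι ℝ q * (iContrL X (decompRe a b) * decompIm a b)) := by
    rw [smul_comm, ← ι_mul_iContrL_top_form hdim hθ, ← mul_smul_comm, ← map_smul, ← hc,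
      iContrL_mul X (decompRe_mem a b),
      mul_comm_graded (decompRe_mem a b) (iContrL_mem X (decompIm_mem a b)),
      iContrL_decompRe_mul_decompIm]
    simp only [mul_add, mul_neg, mul_smul_comm]
    module
  refine smul_left_injective ℝ hθ0 ?_
  simp only
  rw [h1, mul_comm (2 * c), mul_comm 2 c, mul_smul, mul_smul, smul_comm c (2 : ℝ),
    smul_comm _ (2 : ℝ), h2, smul_smul]
  norm_num

lemma iContrL_decomp_of_hitchin {X Y : V}
    (hY : iContrL X ((2 : ℝ) • decompRe a b) * ((2 : ℝ) • decompRe a b) = iContrL Y θ) :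
    iContrL Y (decompRe a b) = (2 * c) • iContrL X (decompIm a b) ∧
    iContrL Y (decompIm a b) = -((2 * c) • iContrL X (decompRe a b)) := by
  refine iContrL_decomp_of_map a b (fun j => ?_) (fun j => ?_)
  · exact dual_apply_of_ι_mul_decomp hdim hθ hθ0 a b hc (ι_mul_decomp a b j).1 hY
  · have := dual_apply_of_ι_mul_decomp hdim hθ hθ0 a b hc (p := b j) (q := -a j)
      (by rw [map_neg, neg_mul, (ι_mul_decomp a b j).2]) hY
    rw [this, LinearMap.neg_apply, mul_neg]

end Uniqueness

lemma decompIm_unique [FiniteDimensional ℝ V] (hdim : Module.finrank ℝ V = 6)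
    {θ : EForm V} (hθ : θ ∈ ⋀[ℝ]^6 (Module.Dual ℝ V)) (hθ0 : θ ≠ 0) {K : V → V}
    {a b a' b' : Fin 3 → Module.Dual ℝ V} (hρ : decompRe a b = decompRe a' b')
    (hK : ∀ X, iContrL X ((2 : ℝ) • decompRe a b) * ((2 : ℝ) • decompRe a b) = iContrL (K X) θ)
    {c c' : ℝ} (hc0 : c < 0) (hc0' : c' < 0) (hc : decompRe a b * decompIm a b = c • θ)
    (hc' : decompRe a' b' * decompIm a' b' = c' • θ) : decompIm a b = decompIm a' b' := by
  have h := fun X => iContrL_decomp_of_hitchin hdim hθ hθ0 a b hc (hK X)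
  have h' := fun X => iContrL_decomp_of_hitchin hdim hθ hθ0 a' b' hc' (hρ ▸ hK X)
  have hne : decompRe a b ≠ 0 := fun h0 => by
    rw [h0, zero_mul] at hc
    exact (smul_ne_zero hc0.ne hθ0) hc.symm
  obtain ⟨X, hX⟩ : ∃ X, iContrL X (decompRe a b) ≠ 0 := by
    by_contra! h0
    exact hne (eq_zero_of_iContrL_eq_zero (decompRe_mem a b) h0)
  have hcc : c = c' := by
    have h1 : iContrL (K (K X)) (decompRe a b) = -((2 * c) ^ 2 • iContrL X (decompRe a b)) := by
      rw [(h (K X)).1, (h X).2, smul_neg, smul_smul, pow_two]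
    have h2 : iContrL (K (K X)) (decompRe a b) = -((2 * c') ^ 2 • iContrL X (decompRe a b)) := by
      rw [hρ, (h' (K X)).1, (h' X).2, smul_neg, smul_smul, pow_two]
    have h3 := smul_left_injective ℝ hX (neg_injective (h1.symm.trans h2))
    nlinarith
  subst hcc
  refine eq_of_iContrL_eq (decompIm_mem a b) (decompIm_mem a' b') fun X => ?_
  have h4 := (h X).1
  rw [hρ, (h' X).1] at h4
  exact smul_right_injective _ (mul_ne_zero two_ne_zero hc0.ne) h4.symm

section HitchinEndomorphism

variable [FiniteDimensional ℝ V] (hdim : Module.finrank ℝ V = 6)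
  {θ : EForm V} (hθ : θ ∈ ⋀[ℝ]^6 (Module.Dual ℝ V)) (hθ0 : θ ≠ 0)
  {ω : EForm V} (hω : ω ∈ ⋀[ℝ]^3 (Module.Dual ℝ V))
  {K : V →ₗ[ℝ] V} (hK : ∀ X : V, (iContrL X ω) * ω = iContrL (K X) θ)
include hdim hθ hθ0 hω hK

lemma iContrL_hitchin_self (X : V) : iContrL (K X) (iContrL X ω) = 0 := by
  rcases eq_or_ne X 0 with rfl | hX
  · simp
  have hτ := iContrL_mem X hω
  set Y := K X
  set τ := iContrL X ω with hτdef
  have hXτ : iContrL X τ = 0 := iContrL_self X ω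
  have hθτ : iContrL X (iContrL Y θ) = τ * τ := by
    rw [← hK, iContrL_mul X hτ, ← hτdef, hXτ]
    simp
  have hβτ : iContrL Y τ * τ = 0 := by
    have h1 : iContrL Y τ * ω + τ * iContrL Y ω = 0 := by
      have := iContrL_self Y θ
      rw [← hK, iContrL_mul Y hτ] at this
      simpa using this
    have h2 := congrArg (iContrL X) h1
    rw [map_add, iContrL_mul X (iContrL_mem Y hτ), iContrL_mul X hτ, iContrL_comm X Y τ,
      iContrL_comm X Y ω, ← hτdef, hXτ, map_zero, map_zero, mul_neg,
      mul_comm_graded hτ (iContrL_mem Y hτ)] at h2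
    have h3 : (-2 : ℝ) • (iContrL Y τ * τ) = 0 := by
      rw [← h2]
      simp only [neg_zero, zero_mul, zero_add]
      module
    exact (smul_eq_zero.mp h3).resolve_left (by norm_num)
  obtain ⟨f, hf⟩ : iContrL Y τ ∈ LinearMap.range (ExteriorAlgebra.ι ℝ) := by
    have := iContrL_mem Y hτ
    rwa [exteriorPower, pow_one] at this
  by_cases hf0 : f = 0
  · rw [← hf, hf0, map_zero]
  obtain ⟨Z, hZ⟩ : ∃ Z, f Z ≠ 0 := by
    by_contra! h
    exact hf0 (LinearMap.ext h)
  have hττ : τ * τ = 0 := by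
    rw [← hf] at hβτ
    have h1 := iContrL_ι_mul Z f τ
    rw [hβτ, map_zero, eq_comm, sub_eq_zero] at h1
    have h2 : f Z • (τ * τ) = 0 := by
      rw [← smul_mul_assoc, h1, ι_mul_comm_graded f (iContrL_mem Z hτ), smul_mul_assoc,
        mul_assoc, hβτ, mul_zero, smul_zero]
    exact (smul_eq_zero.mp h2).resolve_left hZ
  obtain ⟨c, hc⟩ := exists_eq_smul_of_iContrL_iContrL_top_form hdim hθ hθ0 hX (hθτ.trans hττ)
  rw [hc, iContrL_smul_left, hXτ, smul_zero]

lemma iContrL_hitchin_comm (X Y : V) :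
    iContrL (K X) (iContrL Y ω) = iContrL X (iContrL (K Y) ω) := by
  have h := iContrL_hitchin_self hdim hθ hθ0 hω hK (X + Y)
  simp only [map_add, LinearMap.add_apply, iContrL_hitchin_self hdim hθ hθ0 hω hK] at h
  rw [iContrL_comm X, ← add_eq_zero_iff_eq_neg, ← h]
  abel

lemma exists_hitchin_comp_self : ∃ μ : ℝ, K ∘ₗ K = μ • LinearMap.id := by
  refine LinearMap.exists_eq_smul_id_of_forall_notLinearIndependent (f := K ∘ₗ K) fun X => ?_
  have h0 := iContrL_hitchin_self hdim hθ hθ0 hω hK X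
  have h1 : iContrL X ω * iContrL (K X) ω = 0 := by
    have := iContrL_self (K X) θ
    rw [← hK, iContrL_mul (K X) (iContrL_mem X hω), h0] at this
    simpa using this
  have h2 : iContrL X (iContrL (K (K X)) θ) = 0 := by
    rw [← hK, iContrL_mul X (iContrL_mem (K X) hω), iContrL_comm X, h0,
      mul_comm_graded (iContrL_mem (K X) hω) (iContrL_mem X hω), h1]
    simp
  rcases eq_or_ne X 0 with rfl | hX
  · exact fun h => h.ne_zero 0 rfl
  obtain ⟨c, hc⟩ := exists_eq_smul_of_iContrL_iContrL_top_form hdim hθ hθ0 hX h2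
  rw [LinearIndependent.pair_iff' hX]
  push Not
  exact ⟨c, hc.symm⟩

end HitchinEndomorphism

/-- The trilinear map associated with a 3-form. -/
def triEval (η : EForm V) (X Y Z : V) : ℝ := algebraMapInv (iContrL Z (iContrL Y (iContrL X η)))

lemma eq_zero_of_triEval [FiniteDimensional ℝ V] {η : EForm V}
    (hη : η ∈ ⋀[ℝ]^3 (Module.Dual ℝ V)) (h : ∀ X Y Z, triEval η X Y Z = 0) : η = 0 := by
  refine eq_zero_of_iContrL_eq_zero hη fun X => ?_
  refine eq_zero_of_iContrL_eq_zero (iContrL_mem X hη) fun Y => ?_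
  refine eq_zero_of_iContrL_eq_zero (iContrL_mem Y (iContrL_mem X hη)) fun Z => ?_
  have hmem := iContrL_mem Z (iContrL_mem Y (iContrL_mem X hη))
  rw [exteriorPower, pow_zero, Submodule.mem_one] at hmem
  obtain ⟨r, hr⟩ := hmem
  have h0 := h X Y Z
  rw [triEval, ← hr, algebraMap_leftInverse] at h0
  rw [← hr, h0, map_zero]

lemma triEval_sub (η ξ : EForm V) (X Y Z : V) :
    triEval (η - ξ) X Y Z = triEval η X Y Z - triEval ξ X Y Z := by
  simp only [triEval, map_sub]

lemma triEval_ι_mul_ι_mul_ι (f g h : Module.Dual ℝ V) (X Y Z : V) :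
    triEval (ExteriorAlgebra.ι ℝ f * ExteriorAlgebra.ι ℝ g * ExteriorAlgebra.ι ℝ h) X Y Z
      = f X * (g Y * h Z - g Z * h Y) - g X * (f Y * h Z - f Z * h Y)
        + h X * (f Y * g Z - f Z * g Y) := by
  simp only [triEval, iContrL_ι_mul_ι_mul_ι, map_add, map_sub, map_smul, iContrL_ι_mul, iContrL_ι,
    Algebra.algebraMap_eq_smul_one, mul_smul_comm, mul_one, map_one, smul_eq_mul]
  ring

lemma triEval_decompRe (F : Fin 3 → V → ℂ) (a b : Fin 3 → Module.Dual ℝ V)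
    (ha : ∀ j X, a j X = (F j X).re) (hb : ∀ j X, b j X = (F j X).im) (X Y Z : V) :
    triEval (decompRe a b) X Y Z =
      (F 0 X * (F 1 Y * F 2 Z - F 1 Z * F 2 Y) - F 1 X * (F 0 Y * F 2 Z - F 0 Z * F 2 Y)
        + F 2 X * (F 0 Y * F 1 Z - F 0 Z * F 1 Y)).re := by
  simp only [decompRe, triEval_sub, triEval_ι_mul_ι_mul_ι, ha, hb, Complex.add_re, Complex.sub_re,
    Complex.mul_re, Complex.sub_im, Complex.mul_im]
  ring

lemma trilinear_eq_det {W : Type*} [AddCommGroup W] [Module ℂ W] (e : Module.Basis (Fin 3) ℂ W)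
    (f : W → W → W → ℂ) (hadd : ∀ X X' Y Z, f (X + X') Y Z = f X Y Z + f X' Y Z)
    (hsmul : ∀ (c : ℂ) X Y Z, f (c • X) Y Z = c * f X Y Z)
    (h12 : ∀ X Y Z, f X Y Z = -f Y X Z) (h23 : ∀ X Y Z, f X Y Z = -f X Z Y) (X Y Z : W) :
    f X Y Z = f (e 0) (e 1) (e 2) *
      (e.coord 0 X * (e.coord 1 Y * e.coord 2 Z - e.coord 1 Z * e.coord 2 Y)
        - e.coord 1 X * (e.coord 0 Y * e.coord 2 Z - e.coord 0 Z * e.coord 2 Y)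
        + e.coord 2 X * (e.coord 0 Y * e.coord 1 Z - e.coord 0 Z * e.coord 1 Y)) := by
  have hadd2 (X Y Y' Z) : f X (Y + Y') Z = f X Y Z + f X Y' Z := by
    rw [h12, hadd, h12 X Y, h12 X Y']; ring
  have hsmul2 (c : ℂ) (X Y Z) : f X (c • Y) Z = c * f X Y Z := by
    rw [h12, hsmul, h12 X Y]; ring
  have hadd3 (X Y Z Z') : f X Y (Z + Z') = f X Y Z + f X Y Z' := by
    rw [h23, hadd2, h23 X Y, h23 X Y Z']; ring
  have hsmul3 (c : ℂ) (X Y Z) : f X Y (c • Z) = c * f X Y Z := by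
    rw [h23, hsmul2, h23 X Y]; ring
  have h0 (X Z) : f X X Z = 0 := self_eq_neg.mp (h12 X X Z)
  have h0' (X Z) : f Z X X = 0 := self_eq_neg.mp (h23 Z X X)
  have h0'' (X Z) : f X Z X = 0 := by rw [h12, h0', neg_zero]
  have hsum (X : W) : X = e.coord 0 X • e 0 + e.coord 1 X • e 1 + e.coord 2 X • e 2 := by
    conv_lhs => rw [← e.sum_repr X, Fin.sum_univ_three]
    rfl
  conv_lhs => rw [hsum X, hsum Y, hsum Z]
  simp only [hadd, hsmul, hadd2, hsmul2, hadd3, hsmul3, h0, h0', h0'']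
  rw [h12 (e 2) (e 1) (e 0), h23 (e 1) (e 2) (e 0), h12 (e 1) (e 0) (e 2), h23 (e 0) (e 2) (e 1),
    h12 (e 2) (e 0) (e 1), h23 (e 0) (e 2) (e 1)]
  ring

lemma exists_decompRe_of_complex_basis [FiniteDimensional ℝ V] [Module ℂ V] [IsScalarTower ℝ ℂ V]
    (e : Module.Basis (Fin 3) ℂ V) {ω : EForm V} (hω : ω ∈ ⋀[ℝ]^3 (Module.Dual ℝ V))
    (hI : ∀ X Y : V, iContrL (Complex.I • X) (iContrL Y ω) = iContrL X (iContrL (Complex.I • Y) ω)) :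
    ∃ a b : Fin 3 → Module.Dual ℝ V, ω = (2 : ℝ) • decompRe a b := by
  set f : V → V → V → ℂ := fun X Y Z =>
    (triEval ω X Y Z : ℂ) - Complex.I * triEval ω (Complex.I • X) Y Z with hf
  have hw12 (X Y Z) : triEval ω X Y Z = -triEval ω Y X Z := by
    rw [triEval, iContrL_comm Y X, map_neg, map_neg, triEval]
  have hw23 (X Y Z) : triEval ω X Y Z = -triEval ω X Z Y := by
    rw [triEval, iContrL_comm Z Y, map_neg, triEval]
  have hwadd (X X' Y Z) : triEval ω (X + X') Y Z = triEval ω X Y Z + triEval ω X' Y Z := by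
    simp only [triEval, map_add, LinearMap.add_apply]
  have hwsmul (c : ℝ) (X Y Z) : triEval ω (c • X) Y Z = c * triEval ω X Y Z := by
    simp only [triEval, map_smul, LinearMap.smul_apply, smul_eq_mul]
  have hwI (X Y Z) : triEval ω (Complex.I • X) Y Z = triEval ω X (Complex.I • Y) Z := by
    rw [triEval, triEval, ← hI Y X]
  have hcoe (r : ℝ) (X : V) : (r : ℂ) • X = r • X := algebraMap_smul ℂ r X
  have hsmul_eq (c : ℂ) (X : V) : c • X = c.re • X + c.im • (Complex.I • X) := by
    conv_lhs => rw [← Complex.re_add_im c, add_smul, mul_smul, hcoe, hcoe]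
  have hII (X : V) : Complex.I • Complex.I • X = (-1 : ℝ) • X := by
    rw [smul_smul, Complex.I_mul_I, neg_smul, neg_smul, one_smul, one_smul]
  have hdet := trilinear_eq_det e f
    (fun X X' Y Z => by simp only [hf, smul_add, hwadd]; push_cast; ring)
    (fun c X Y Z => by
      have h1 : Complex.I • c • X = (-c.im) • X + c.re • (Complex.I • X) := by
        rw [smul_comm, hsmul_eq c, hII, smul_smul, mul_neg_one, add_comm]
      simp only [hf, h1]
      rw [hsmul_eq c]
      simp only [hwadd, hwsmul]
      apply Complex.ext <;> simp)
    (fun X Y Z => by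
      simp only [hf]
      rw [hw12 X Y, hwI X Y, hw12 X]
      push_cast; ring)
    (fun X Y Z => by
      simp only [hf]
      rw [hw23 X Y, hw23 _ Y]
      push_cast; ring)
  set F : Fin 3 → V →ₗ[ℂ] ℂ :=
    ![(f (e 0) (e 1) (e 2) / 2) • e.coord 0, e.coord 1, e.coord 2] with hF
  refine ⟨fun j => Complex.reLm ∘ₗ (F j).restrictScalars ℝ,
    fun j => Complex.imLm ∘ₗ (F j).restrictScalars ℝ, ?_⟩
  refine sub_eq_zero.mp (eq_zero_of_triEval
    (sub_mem hω (Submodule.smul_mem _ _ (decompRe_mem _ _))) fun X Y Z => ?_)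
  have h2 (η : EForm V) : triEval ((2 : ℝ) • η) X Y Z = 2 * triEval η X Y Z := by
    simp only [triEval, map_smul, smul_eq_mul]
  have hre : triEval ω X Y Z = (f X Y Z).re := by simp [hf]
  rw [triEval_sub, h2, triEval_decompRe (fun j => F j) _ _ (fun _ _ => rfl) (fun _ _ => rfl), hre,
    hdet, ← Complex.re_ofReal_mul, ← Complex.sub_re]
  convert Complex.zero_re
  simp only [hF, Matrix.cons_val, LinearMap.smul_apply, smul_eq_mul]
  push_cast
  ring

lemma exists_decompRe_of_complex_structure [FiniteDimensional ℝ V]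
    (hdim : Module.finrank ℝ V = 6) {ω : EForm V} (hω : ω ∈ ⋀[ℝ]^3 (Module.Dual ℝ V))
    (J : Module.End ℝ V) (hJ : J * J = -1)
    (hJω : ∀ X Y : V, iContrL (J X) (iContrL Y ω) = iContrL X (iContrL (J Y) ω)) :
    ∃ a b : Fin 3 → Module.Dual ℝ V, ω = (2 : ℝ) • decompRe a b := by
  let _ : Module ℂ V := Module.compHom V (Complex.liftAux J hJ).toRingHom
  have hsmul (c : ℂ) (X : V) : c • X = Complex.liftAux J hJ c X := rfl
  have : IsScalarTower ℝ ℂ V := ⟨fun r c X => by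
    rw [hsmul, hsmul, map_smul, LinearMap.smul_apply]⟩
  have : Module.Finite ℂ V := Module.Finite.of_restrictScalars_finite ℝ ℂ V
  have h3 : Module.finrank ℂ V = 3 := by
    have := Module.finrank_mul_finrank ℝ ℂ V
    rw [Complex.finrank_real_complex, hdim] at this
    omega
  refine exists_decompRe_of_complex_basis (Module.finBasisOfFinrankEq ℂ V h3) hω fun X Y => ?_
  rw [hsmul, hsmul, Complex.liftAux_apply_I]
  exact hJω X Y

/-- Hitchin: if `λ(ω) < 0` then `ω = α + ᾱ` for a complex decomposable 3-form
`α = ρ + iσ` (so `ω = 2ρ`); moreover `α` is unique subject to `(α ∧ ᾱ)/(iθ) > 0`,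
which in terms of real and imaginary parts reads `(ρ ∧ σ)/θ < 0`. -/
theorem hitchin_decomposition_neg [FiniteDimensional ℝ V]
    (hdim : Module.finrank ℝ V = 6)
    (θ : EForm V) (hθ : θ ∈ ⋀[ℝ]^6 (Module.Dual ℝ V)) (hθ0 : θ ≠ 0)
    (ω : EForm V) (hω : ω ∈ ⋀[ℝ]^3 (Module.Dual ℝ V))
    (K : V →ₗ[ℝ] V)
    (hK : ∀ X : V, (iContrL X ω) * ω = iContrL (K X) θ)
    (hlam : (1/6 : ℝ) * LinearMap.trace ℝ V (K ∘ₗ K) < 0) :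
    (∃ ρ σ : EForm V, IsComplexDecompPair ρ σ ∧ ω = (2 : ℝ) • ρ) ∧
    (∀ ρ σ ρ' σ' : EForm V, IsComplexDecompPair ρ σ → IsComplexDecompPair ρ' σ' →
      ω = (2 : ℝ) • ρ → ω = (2 : ℝ) • ρ' →
      (∃ c : ℝ, c < 0 ∧ ρ * σ = c • θ) → (∃ c : ℝ, c < 0 ∧ ρ' * σ' = c • θ) →
      ρ = ρ' ∧ σ = σ') := by
  constructor
  · obtain ⟨μ, hμ⟩ := exists_hitchin_comp_self hdim hθ hθ0 hω hK
    have hμ0 : μ < 0 := by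
      rw [hμ, map_smul, LinearMap.trace_id, hdim, smul_eq_mul] at hlam
      push_cast at hlam
      linarith
    set s := (√(-μ))⁻¹ with hs
    have hs2 : s * s * μ = -1 := by
      rw [hs, ← mul_inv, Real.mul_self_sqrt (by linarith)]
      rw [inv_neg, neg_mul, inv_mul_cancel₀ hμ0.ne]
    have hJ : (s • K : Module.End ℝ V) * (s • K) = -1 := by
      rw [smul_mul_smul_comm, Module.End.mul_eq_comp, hμ, smul_smul, hs2, neg_smul, one_smul]
      rfl
    obtain ⟨a, b, hab⟩ := exists_decompRe_of_complex_structure hdim hω (s • K) hJ fun X Y => by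
      simp only [LinearMap.smul_apply, map_smul]
      rw [iContrL_hitchin_comm hdim hθ hθ0 hω hK]
    exact ⟨decompRe a b, decompIm a b, ⟨a, b, rfl, rfl⟩, hab⟩
  · rintro ρ σ ρ' σ' ⟨a, b, hρ, hσ⟩ ⟨a', b', hρ', hσ'⟩ h h' ⟨c, hc0, hc⟩ ⟨c', hc0', hc'⟩
    change ρ = decompRe a b at hρ
    change ρ' = decompRe a' b' at hρ'
    change σ = decompIm a b at hσ
    change σ' = decompIm a' b' at hσ'
    subst hρ hρ' hσ hσ'
    have hρρ : decompRe a b = decompRe a' b' :=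
      smul_right_injective _ (two_ne_zero (α := ℝ)) (h.symm.trans h')
    subst h
    exact ⟨hρρ, decompIm_unique hdim hθ hθ0 hρρ hK hc0 hc0' hc hc'⟩
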